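/- Let d ≥ 2 and let (Ω_t(x)) be the specific family: for |x| ≤ 1, Ω₁(x) := {h ∈ ℝ^d : |x+h| ≤ 2}; for |x| > 1, Ω₁(x) := {h ∈ ℝ^d : ∃ τ > 0 ∃ y ∈ ℝ^d with x+h = τy, |y| = |x|, ⟨x,y⟩ > |x|² − 1/2 and |x| − 1/2 < τ|x| < |x| + 1/2}; and Ω_t(x) := t·Ω₁(x) for t > 0. Let g : ℝ → ℂ be an even function and f(x) := g(|x|) the associated radial function on ℝ^d. Then for every r ≥ 0 and t > 0: sup_{|w| ≤ t/4} |g(r+w) − g(r)| ≤ sup_{h ∈ Ω_t(re₁)} |f(re₁ + h) − f(re₁)| ≤ sup_{|w| ≤ 3t} |g(r+w) − g(r)|, where e₁ = (1,0,…,0). -/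

import Mathlib

open MeasureTheory Set
open scoped ENNReal NNReal RealInnerProductSpace Pointwise

noncomputable section

abbrev E (d : ℕ) := EuclideanSpace ℝ (Fin d)

def e1 (d : ℕ) : E d := (EuclideanSpace.equiv (Fin d) ℝ).symm (fun i => if (i : ℕ) = 0 then 1 else 0)

/-- the set `Ω₁(x)` of (2.7)/(2.8) -/
def Omega1 (d : ℕ) (x : E d) : Set (E d) :=
  if ‖x‖ ≤ 1 then {h | ‖x + h‖ ≤ 2}
  else {h | ∃ τ : ℝ, 0 < τ ∧ ∃ y : E d, x + h = τ • y ∧ ‖y‖ = ‖x‖ ∧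
    ⟪x, y⟫ > ‖x‖ ^ 2 - 1 / 2 ∧ ‖x‖ - 1 / 2 < τ * ‖x‖ ∧ τ * ‖x‖ < ‖x‖ + 1 / 2}

/-- the scaled family `Ω_t(x) = t·Ω₁(x)` of (2.9) -/
def OmegaT (d : ℕ) (t : ℝ) (x : E d) : Set (E d) := t • Omega1 d x

theorem norm_e1_aux (d : ℕ) (hd : 2 ≤ d) : ‖e1 d‖ = 1 := by
  obtain ⟨n, rfl⟩ : ∃ n, d = n + 1 := ⟨d - 1, by omega⟩
  have h : e1 (n + 1) = EuclideanSpace.single (0 : Fin (n + 1)) (1 : ℝ) := by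
    ext i
    have h0 : (i = 0) = ((i : ℕ) = 0) := propext Fin.ext_iff
    show (if (i : ℕ) = 0 then (1 : ℝ) else 0) = _
    rw [PiLp.single_apply]
    simp only [h0]
  rw [h]
  simp

/-- **Step 3 of the proof of Theorem 2.2**: for an even `g` and the associated radial
function `f(x)=g(|x|)`,
`sup_{|w|≤t/4}|g(r+w)-g(r)| ≤ sup_{h∈Ω_t(re₁)}|f(re₁+h)-f(re₁)| ≤ sup_{|w|≤3t}|g(r+w)-g(r)|`. -/
theorem sup_omega_between_sup_diffs (d : ℕ) (hd : 2 ≤ d)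
    (g : ℝ → ℂ) (hg : ∀ w : ℝ, g (-w) = g w) (r t : ℝ) (hr : 0 ≤ r) (ht : 0 < t) :
    (⨆ (w : ℝ) (_ : |w| ≤ t / 4), (‖g (r + w) - g r‖₊ : ℝ≥0∞)) ≤
      (⨆ (h : E d) (_ : h ∈ OmegaT d t (r • e1 d)),
        (‖g ‖r • e1 d + h‖ - g ‖r • e1 d‖‖₊ : ℝ≥0∞)) ∧
    (⨆ (h : E d) (_ : h ∈ OmegaT d t (r • e1 d)),
        (‖g ‖r • e1 d + h‖ - g ‖r • e1 d‖‖₊ : ℝ≥0∞)) ≤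
      ⨆ (w : ℝ) (_ : |w| ≤ 3 * t), (‖g (r + w) - g r‖₊ : ℝ≥0∞) := by
  have he := norm_e1_aux d hd
  have hs : ∀ a : ℝ, ‖a • e1 d‖ = |a| := fun a => by rw [norm_smul, he]; simp
  have hx : ‖r • e1 d‖ = r := by rw [hs, abs_of_nonneg hr]
  have hga : ∀ a : ℝ, g |a| = g a := fun a => by
    rcases abs_choice a with h | h <;> rw [h]
    exact hg a
  constructor
  · refine iSup₂_le fun w hw => ?_
    have hmem : w • e1 d ∈ OmegaT d t (r • e1 d) := by
      refine ⟨(w / t) • e1 d, ?_, ?_⟩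
      · have hwt : |w / t| ≤ 1 / 4 := by
          rw [abs_div, abs_of_pos ht, div_le_iff₀ ht]; linarith
        have hwt' := abs_le.1 hwt
        unfold Omega1
        rw [hx]
        split_ifs with h1
        · show ‖r • e1 d + (w / t) • e1 d‖ ≤ 2
          rw [← add_smul, hs, abs_le]
          constructor <;> linarith
        · push Not at h1
          have hr0 : r ≠ 0 := by linarith
          have h2 : (r + w / t) / r * r = r + w / t := by field_simp
          refine ⟨(r + w / t) / r, div_pos (by linarith) (by linarith), r • e1 d, ?_, hx, ?_, ?_, ?_⟩
          · rw [← add_smul, smul_smul, h2]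
          · rw [real_inner_self_eq_norm_sq, hx]; linarith
          · rw [h2]; linarith
          · rw [h2]; linarith
      · show t • (w / t) • e1 d = w • e1 d
        rw [smul_smul, mul_div_cancel₀ _ ht.ne']
    refine le_trans (le_of_eq ?_) (le_iSup₂ (w • e1 d) hmem)
    rw [← add_smul, hs, hx, hga]
  · refine iSup₂_le fun h hh => ?_
    obtain ⟨k, hk, rfl⟩ := hh
    have hk3 : ‖k‖ ≤ 3 := by
      unfold Omega1 at hk
      rw [hx] at hk
      split_ifs at hk with h1
      · have hk' : ‖r • e1 d + k‖ ≤ 2 := hk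
        have := norm_sub_le (r • e1 d + k) (r • e1 d)
        rw [add_sub_cancel_left] at this
        linarith
      · obtain ⟨τ, hτ, y, hy, hyn, hin, h3, h4⟩ := hk
        have e : k = (τ - 1) • y + (y - r • e1 d) := by
          rw [sub_smul, ← hy, one_smul]; abel
        have a1 : ‖(τ - 1) • y‖ ≤ 1 / 2 := by
          rw [norm_smul, hyn, Real.norm_eq_abs]
          have : |τ - 1| * r = |(τ - 1) * r| := by rw [abs_mul, abs_of_nonneg hr]
          rw [this, abs_le]
          constructor <;> linarith
        have a2 : ‖y - r • e1 d‖ ≤ 1 := by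
          have := norm_sub_sq_real y (r • e1 d)
          rw [hyn, hx, real_inner_comm] at this
          nlinarith [norm_nonneg (y - r • e1 d)]
        rw [e]
        linarith [norm_add_le ((τ - 1) • y) (y - r • e1 d)]
    have hw : |‖r • e1 d + t • k‖ - r| ≤ 3 * t := by
      have := abs_norm_sub_norm_le (r • e1 d + t • k) (r • e1 d)
      rw [add_sub_cancel_left, hx, norm_smul, Real.norm_eq_abs, abs_of_pos ht] at this
      nlinarith
    refine le_trans (le_of_eq ?_) (le_iSup₂ (‖r • e1 d + t • k‖ - r) hw)
    simp only [hx, add_sub_cancel]
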